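/- arXiv:2211.02962 — 8 statements merged into one kernel-verified Lean document; each statement's English description precedes it below -/
import Mathlib

section
/- Let X be a topological space such that every finite power X^k (k ≥ 1, with the product topology) is star-Rothberger. Then X satisfies S₁*(Ω,Ω): for every sequence (𝒰ₙ)_{n∈ℕ} of ω-covers of X there exist Uₙ ∈ 𝒰ₙ such that every finite subset of X is contained in St(Uₙ,𝒰ₙ) for some n ∈ ℕ. -/
open Set Filter

/-- The star of a set `A` with respect to a family `P` of sets:
the union of all members of `P` that meet `A`. -/
def st {X : Type*} (A : Set X) (P : Set (Set X)) : Set X :=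
  ⋃₀ {B | B ∈ P ∧ (A ∩ B).Nonempty}

/-- `P` is an open cover of the space `X`. -/
def IsOpenCover {X : Type*} [TopologicalSpace X] (P : Set (Set X)) : Prop :=
  (∀ U ∈ P, IsOpen U) ∧ ⋃₀ P = Set.univ

/-- `P` is an ω-cover of `X`: an open cover not containing `X` itself such that
every finite subset of `X` is contained in some member. -/
def IsOmegaCover {X : Type*} [TopologicalSpace X] (P : Set (Set X)) : Prop :=
  IsOpenCover P ∧ Set.univ ∉ P ∧ ∀ F : Set X, F.Finite → ∃ U ∈ P, F ⊆ U

/-- `X` is star-Rothberger. -/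
def StarRothberger (X : Type*) [TopologicalSpace X] : Prop :=
  ∀ U : ℕ → Set (Set X), (∀ n, IsOpenCover (U n)) →
    ∃ V : ℕ → Set X, (∀ n, V n ∈ U n) ∧ (⋃ n, st (V n) (U n)) = Set.univ

/-- The family of `ι`-th powers of the members of `P`. -/
def powerFamily {X : Type*} (ι : Type*) (P : Set (Set X)) : Set (Set (ι → X)) :=
  (fun A : Set X => Set.univ.pi fun _ : ι => A) '' P

theorem IsOmegaCover.isOpenCover_powerFamily {X ι : Type*} [TopologicalSpace X] [Finite ι]
    {P : Set (Set X)} (hP : IsOmegaCover P) : IsOpenCover (powerFamily ι P) := by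
  obtain ⟨⟨hopen, -⟩, -, hfin⟩ := hP
  refine ⟨?_, Set.eq_univ_of_forall fun x => ?_⟩
  · rintro _ ⟨A, hA, rfl⟩
    exact isOpen_set_pi Set.finite_univ fun _ _ => hopen A hA
  · obtain ⟨A, hA, hx⟩ := hfin (Set.range x) (Set.finite_range x)
    exact ⟨_, ⟨A, hA, rfl⟩, fun i _ => hx (Set.mem_range_self i)⟩

theorem range_subset_st_of_mem_st_powerFamily {X ι : Type*} [Nonempty ι]
    {P : Set (Set X)} {A : Set X} {x : ι → X}
    (hx : x ∈ st (Set.univ.pi fun _ : ι => A) (powerFamily ι P)) :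
    Set.range x ⊆ st A P := by
  obtain ⟨_, ⟨⟨B, hB, rfl⟩, y, hyA, hyB⟩, hxB⟩ := hx
  rintro _ ⟨i, rfl⟩
  exact ⟨B, ⟨hB, y i, hyA i (Set.mem_univ i), hyB i (Set.mem_univ i)⟩, hxB i (Set.mem_univ i)⟩

/-- If every finite power of `X` is star-Rothberger, then `X` satisfies `S₁*(Ω,Ω)`. -/
theorem stmt0 {X : Type*} [TopologicalSpace X]
    (h : ∀ k : ℕ, 1 ≤ k → StarRothberger (Fin k → X)) :
    ∀ U : ℕ → Set (Set X), (∀ n, IsOmegaCover (U n)) →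
      ∃ V : ℕ → Set X, (∀ n, V n ∈ U n) ∧
        ∀ F : Set X, F.Finite → ∃ n, F ⊆ st (V n) (U n) := by
  intro U hU
  have hpow (k : ℕ) : ∃ V : ℕ → Set X, (∀ j, V j ∈ U (Nat.pair k j)) ∧
      ∀ x : Fin (k + 1) → X, ∃ j, Set.range x ⊆ st (V j) (U (Nat.pair k j)) := by
    obtain ⟨W, hW, hcover⟩ := h (k + 1) (Nat.le_add_left 1 k)
      (fun j => powerFamily (Fin (k + 1)) (U (Nat.pair k j)))
      fun j => (hU _).isOpenCover_powerFamily
    choose V hV hVW using hW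
    refine ⟨V, hV, fun x => ?_⟩
    obtain ⟨j, hj⟩ := Set.mem_iUnion.1 (hcover.symm ▸ Set.mem_univ x)
    rw [← hVW j] at hj
    exact ⟨j, range_subset_st_of_mem_st_powerFamily hj⟩
  choose V hV hcover using hpow
  refine ⟨fun n => V n.unpair.1 n.unpair.2, fun n => ?_, fun F hF => ?_⟩
  · simpa using hV n.unpair.1 n.unpair.2
  · obtain ⟨k, x, -, rfl⟩ := hF.fin_param
    cases k with
    | zero => exact ⟨0, by simp [Set.range_eq_empty]⟩
    | succ k =>
      obtain ⟨j, hj⟩ := hcover k x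
      exact ⟨Nat.pair k j, by simpa using hj⟩
end

section
/- Let X be a topological space such that every finite power X^k (k ≥ 1, with the product topology) is strongly star-Rothberger. Then X satisfies SS₁*(Ω,Ω): for every sequence (𝒰ₙ)_{n∈ℕ} of ω-covers of X there exist points xₙ ∈ X such that every finite subset of X is contained in St(xₙ,𝒰ₙ) for some n ∈ ℕ. -/
open Set Filter

/-- `X` is strongly star-Rothberger. -/
def StronglyStarRothberger (X : Type*) [TopologicalSpace X] : Prop :=
  ∀ U : ℕ → Set (Set X), (∀ n, IsOpenCover (U n)) →
    ∃ x : ℕ → X, (⋃ n, st {x n} (U n)) = Set.univ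

/-- The cover of `ι → X` by the cubes over the members of `P`. -/
def cubes (ι : Type*) {X : Type*} (P : Set (Set X)) : Set (Set (ι → X)) :=
  (fun B => Set.pi Set.univ fun _ => B) '' P

theorem IsOmegaCover.isOpenCover_cubes {ι X : Type*} [Finite ι] [TopologicalSpace X]
    {P : Set (Set X)} (hP : IsOmegaCover P) : IsOpenCover (cubes ι P) := by
  refine ⟨?_, Set.eq_univ_of_forall fun f => ?_⟩
  · rintro _ ⟨B, hB, rfl⟩
    exact isOpen_set_pi Set.finite_univ fun _ _ => hP.1.1 B hB
  · obtain ⟨B, hB, hf⟩ := hP.2.2 (Set.range f) (Set.finite_range f)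
    exact ⟨_, ⟨B, hB, rfl⟩, fun i _ => hf ⟨i, rfl⟩⟩

theorem range_subset_st_of_mem_st_cubes {ι X : Type*} {P : Set (Set X)} {f y : ι → X}
    (hf : f ∈ st {y} (cubes ι P)) (i : ι) : Set.range f ⊆ st {y i} P := by
  obtain ⟨_, ⟨⟨B, hB, rfl⟩, _, rfl, hy⟩, hfB⟩ := hf
  rintro _ ⟨j, rfl⟩
  exact ⟨B, ⟨hB, _, rfl, hy i trivial⟩, hfB j trivial⟩

/-- If every finite power of `X` is strongly star-Rothberger,
then `X` satisfies `SS₁*(Ω,Ω)`. -/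
theorem stmt1 {X : Type*} [TopologicalSpace X]
    (h : ∀ k : ℕ, 1 ≤ k → StronglyStarRothberger (Fin k → X)) :
    ∀ U : ℕ → Set (Set X), (∀ n, IsOmegaCover (U n)) →
      ∃ x : ℕ → X, ∀ F : Set X, F.Finite → ∃ n, F ⊆ st {x n} (U n) := by
  intro U hU
  have hcover (k : ℕ) : ∃ y : ℕ → Fin (k + 1) → X,
      (⋃ m, st {y m} (cubes (Fin (k + 1)) (U (Nat.pair k m)))) = Set.univ :=
    h (k + 1) k.succ_pos _ fun m => (hU _).isOpenCover_cubes
  choose y hy using hcover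
  refine ⟨fun n => y n.unpair.1 n.unpair.2 0, fun F hF => ?_⟩
  obtain ⟨k, f, -, rfl⟩ := hF.fin_param
  cases k with
  | zero => exact ⟨0, by simp [Set.range_eq_empty]⟩
  | succ k =>
    obtain ⟨m, hm⟩ := Set.mem_iUnion.1 ((hy k).symm ▸ Set.mem_univ f)
    refine ⟨Nat.pair k m, ?_⟩
    dsimp only
    rw [Nat.unpair_pair]
    exact range_subset_st_of_mem_st_cubes hm 0
end

section
/- Let X be a topological space such that every finite power X^k (k ≥ 1, with the product topology) is star-K-Menger. Then X satisfies SS*_comp(𝒪,Ω): for every sequence (𝒰ₙ)_{n∈ℕ} of open covers of X there exist compact sets Kₙ ⊆ X such that every finite subset of X is contained in St(Kₙ,𝒰ₙ) for some n ∈ ℕ. -/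
open Set Filter

/-- `X` is star-K-Menger. -/
def StarKMenger (X : Type*) [TopologicalSpace X] : Prop :=
  ∀ U : ℕ → Set (Set X), (∀ n, IsOpenCover (U n)) →
    ∃ K : ℕ → Set X, (∀ n, IsCompact (K n)) ∧ (⋃ n, st (K n) (U n)) = Set.univ

/-- The family of boxes in `ι → X` with all sides in `P`. -/
def boxes {X : Type*} (ι : Type*) (P : Set (Set X)) : Set (Set (ι → X)) :=
  {B | ∃ V : ι → Set X, (∀ i, V i ∈ P) ∧ B = Set.univ.pi V}

theorem IsOpenCover.boxes {X ι : Type*} [TopologicalSpace X] [Finite ι] {P : Set (Set X)}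
    (hP : IsOpenCover P) : IsOpenCover (boxes ι P) := by
  refine ⟨?_, ?_⟩
  · rintro _ ⟨V, hV, rfl⟩
    exact isOpen_set_pi Set.finite_univ fun i _ => hP.1 _ (hV i)
  · refine Set.eq_univ_of_forall fun x => ?_
    have hx : ∀ i, ∃ V ∈ P, x i ∈ V := fun i => by
      rw [← Set.mem_sUnion, hP.2]
      trivial
    choose V hV hxV using hx
    exact ⟨Set.univ.pi V, ⟨V, hV, rfl⟩, fun i _ => hxV i⟩

/-- The coordinates of a point of `st C (boxes ι P)` lie in the star of the union of the
projections of `C`. -/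
theorem range_subset_st_of_mem_st_boxes {X ι : Type*} {P : Set (Set X)} {C : Set (ι → X)}
    {x : ι → X} (hx : x ∈ st C (boxes ι P)) :
    Set.range x ⊆ st (⋃ i, Function.eval i '' C) P := by
  obtain ⟨_, ⟨⟨V, hV, rfl⟩, c, hcC, hcV⟩, hxV⟩ := hx
  rintro _ ⟨i, rfl⟩
  exact ⟨V i, ⟨hV i, c i, Set.mem_iUnion.2 ⟨i, c, hcC, rfl⟩, hcV i trivial⟩, hxV i trivial⟩

/-- If every finite power of `X` is star-K-Menger, then `X` satisfies
`SS*_comp(𝒪,Ω)`. -/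
theorem stmt2 {X : Type*} [TopologicalSpace X]
    (h : ∀ k : ℕ, 1 ≤ k → StarKMenger (Fin k → X)) :
    ∀ U : ℕ → Set (Set X), (∀ n, IsOpenCover (U n)) →
      ∃ K : ℕ → Set X, (∀ n, IsCompact (K n)) ∧
        ∀ F : Set X, F.Finite → ∃ n, F ⊆ st (K n) (U n) := by
  intro U hU
  choose C hC hCU using fun k : ℕ => h (k + 1) (Nat.le_add_left 1 k)
    (fun m => boxes (Fin (k + 1)) (U (Nat.pair k m))) fun m => (hU _).boxes
  refine ⟨fun n => ⋃ i, Function.eval i '' C n.unpair.1 n.unpair.2,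
    fun n => isCompact_iUnion fun i => (hC _ _).image (continuous_apply i), fun F hF => ?_⟩
  obtain ⟨k, x, -, rfl⟩ := hF.fin_param
  cases k with
  | zero => exact ⟨0, by simp⟩
  | succ k =>
    obtain ⟨m, hm⟩ := Set.mem_iUnion.1 ((hCU k).symm ▸ Set.mem_univ x)
    refine ⟨Nat.pair k m, ?_⟩
    dsimp only
    rw [Nat.unpair_pair]
    exact range_subset_st_of_mem_st_boxes hm
end

section
/- For a topological space X the following are equivalent: (1) X satisfies SS*_comp(𝒪,Ω): for every sequence (𝒰ₙ)_{n∈ℕ} of open covers of X there exist compact sets Kₙ ⊆ X such that every finite subset of X is contained in St(Kₙ,𝒰ₙ) for some n; (2) X satisfies SS*_comp(𝒪,𝒪^wgp): for every sequence (𝒰ₙ)_{n∈ℕ} of open covers of X there exist compact sets Kₙ ⊆ X such that the sequence (St(Kₙ,𝒰ₙ))_{n∈ℕ} is weakly groupable. -/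
open Set Filter

/-- A sequence of subsets of `X` is weakly groupable if there is an increasing
sequence `m 0 < m 1 < ⋯` of naturals such that every finite `F ⊆ X` is contained
in the union of one of the blocks `A (m k), …, A (m (k+1) - 1)`. -/
def WeaklyGroupable {X : Type*} (A : ℕ → Set X) : Prop :=
  ∃ m : ℕ → ℕ, StrictMono m ∧ ∀ F : Set X, F.Finite →
    ∃ k, F ⊆ ⋃ i ∈ Set.Ico (m k) (m (k + 1)), A i

theorem st_subset_st {X : Type*} {A B : Set X} {P Q : Set (Set X)} (hAB : A ⊆ B)
    (hPQ : ∀ V ∈ P, ∃ W ∈ Q, V ⊆ W) : st A P ⊆ st B Q := by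
  rintro x ⟨V, ⟨hV, hAV⟩, hxV⟩
  obtain ⟨W, hW, hVW⟩ := hPQ V hV
  exact ⟨W, ⟨hW, hAV.mono (inter_subset_inter hAB hVW)⟩, hVW hxV⟩

/-- The open sets refining each of the families `U 0, …, U n`. -/
def commonRefinement {X : Type*} [TopologicalSpace X] (U : ℕ → Set (Set X)) (n : ℕ) :
    Set (Set X) :=
  {V | IsOpen V ∧ ∀ j ≤ n, ∃ W ∈ U j, V ⊆ W}

theorem isOpenCover_commonRefinement {X : Type*} [TopologicalSpace X] {U : ℕ → Set (Set X)}
    (hU : ∀ n, IsOpenCover (U n)) (n : ℕ) : IsOpenCover (commonRefinement U n) := by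
  refine ⟨fun V hV => hV.1, eq_univ_of_forall fun x => ?_⟩
  have hx : ∀ j, ∃ W ∈ U j, x ∈ W := fun j => by
    have h : x ∈ ⋃₀ U j := (hU j).2 ▸ mem_univ x
    exact h
  choose W hWU hxW using hx
  refine ⟨⋂ j ∈ Iic n, W j, ⟨?_, fun j hj => ⟨W j, hWU j, biInter_subset_of_mem hj⟩⟩, ?_⟩
  · exact (finite_Iic n).isOpen_biInter fun j _ => (hU j).1 _ (hWU j)
  · exact mem_iInter₂.2 fun j _ => hxW j

/-- `X` satisfies `SS*_comp(𝒪,Ω)` iff `X` satisfies `SS*_comp(𝒪,𝒪^wgp)`. -/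
theorem stmt3 {X : Type*} [TopologicalSpace X] :
    (∀ U : ℕ → Set (Set X), (∀ n, IsOpenCover (U n)) →
      ∃ K : ℕ → Set X, (∀ n, IsCompact (K n)) ∧
        ∀ F : Set X, F.Finite → ∃ n, F ⊆ st (K n) (U n)) ↔
    (∀ U : ℕ → Set (Set X), (∀ n, IsOpenCover (U n)) →
      ∃ K : ℕ → Set X, (∀ n, IsCompact (K n)) ∧
        WeaklyGroupable (fun n => st (K n) (U n))) := by
  constructor
  · intro h U hU
    obtain ⟨K, hK, hF⟩ := h U hU
    refine ⟨K, hK, id, strictMono_id, fun F hfin => ?_⟩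
    obtain ⟨n, hn⟩ := hF F hfin
    exact ⟨n, hn.trans (subset_biUnion_of_mem (u := fun i => st (K i) (U i))
      (left_mem_Ico.2 n.lt_succ_self))⟩
  · intro h U hU
    obtain ⟨K, hK, m, hm, hF⟩ := h (commonRefinement U) (isOpenCover_commonRefinement hU)
    refine ⟨fun k => ⋃ i ∈ Ico (m k) (m (k + 1)), K i,
      fun k => (finite_Ico _ _).isCompact_biUnion fun i _ => hK i, fun F hfin => ?_⟩
    obtain ⟨k, hk⟩ := hF F hfin
    refine ⟨k, hk.trans (iUnion₂_subset fun i hi => ?_)⟩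
    exact st_subset_st (subset_biUnion_of_mem (u := K) hi)
      fun V hV => hV.2 k ((hm.id_le k).trans hi.1)
end

section
/- Let X be a topological space with X = ⋃_{k∈ℕ} X_k, where each X_k is strongly star-Rothberger in X: for every sequence (𝒰ₙ)_{n∈ℕ} of open covers of X there exist points xₙ ∈ X such that X_k ⊆ ⋃_{n∈ℕ} St(xₙ,𝒰ₙ). Then X is strongly star-Rothberger. -/
open Set Filter

/-- If `X` is a countable union of subsets each strongly star-Rothberger in `X`,
then `X` is strongly star-Rothberger. -/
theorem stmt14 {X : Type*} [TopologicalSpace X] (Xk : ℕ → Set X)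
    (hcov : (⋃ k, Xk k) = Set.univ)
    (h : ∀ k, ∀ U : ℕ → Set (Set X), (∀ n, IsOpenCover (U n)) →
      ∃ x : ℕ → X, Xk k ⊆ ⋃ n, st {x n} (U n)) :
    StronglyStarRothberger X := by
  intro U hU
  choose x hx using fun k => h k (fun n => U (Nat.pair k n)) fun n => hU _
  refine ⟨fun m => x m.unpair.1 m.unpair.2, eq_univ_of_univ_subset ?_⟩
  rw [← hcov]
  refine iUnion_subset fun k => (hx k).trans (iUnion_subset fun n => ?_)
  refine subset_iUnion_of_subset (Nat.pair k n) ?_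
  simp only [Nat.unpair_pair, subset_refl]
end

section
/- Let X be a star-ε-space with X = ⋃_{α<κ} X_α for a cardinal κ < cov(M), where each subspace X_α satisfies S₁(Ω,Γ): for every sequence (𝒱ₙ)_{n∈ℕ} of ω-covers of X_α there exist Vₙ ∈ 𝒱ₙ such that every point of X_α belongs to Vₙ for all but finitely many n. Then X is star-Rothberger. -/
open Set Filter

/-- `cov(M)`: the least cardinality of a family `F ⊆ ℕ^ℕ` that cannot be
guessed by a single `g ∈ ℕ^ℕ` (i.e. there is no `g` agreeing with every member
of `F` infinitely often). -/
noncomputable def covM : Cardinal :=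
  sInf {c : Cardinal | ∃ F : Set (ℕ → ℕ), Cardinal.mk F = c ∧
    ¬ ∃ g : ℕ → ℕ, ∀ f ∈ F, {n : ℕ | f n = g n}.Infinite}

/-- A space `Z` satisfies `S₁(Ω,Γ)`: for every sequence of ω-covers one can
select a member from each so that every point lies in the selected member
for all but finitely many indices. -/
def S1OmegaGamma (Z : Type*) [TopologicalSpace Z] : Prop :=
  ∀ V : ℕ → Set (Set Z), (∀ n, IsOmegaCover (V n)) →
    ∃ W : ℕ → Set Z, (∀ n, W n ∈ V n) ∧
      ∀ z : Z, ∀ᶠ n in Filter.atTop, z ∈ W n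

/-- `X` is a star-ε-space: for every open cover `P` there is a countable
`V ⊆ P` such that every finite subset of `X` is contained in `St(W,P)` for
some `W ∈ V`. -/
def StarEpsilonSpace (X : Type*) [TopologicalSpace X] : Prop :=
  ∀ P : Set (Set X), IsOpenCover P → ∃ V ⊆ P, V.Countable ∧
    ∀ F : Set X, F.Finite → ∃ W ∈ V, F ⊆ st W P

theorem isOpen_st {X : Type*} [TopologicalSpace X] {P : Set (Set X)}
    (hP : ∀ U ∈ P, IsOpen U) (A : Set X) : IsOpen (st A P) :=
  isOpen_sUnion fun _ hB => hP _ hB.1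

/-- Fewer than `cov(M)` many functions are guessed infinitely often by a single one. -/
theorem exists_infinite_eq_of_mk_lt_covM {ι : Type} (hκ : Cardinal.mk ι < covM)
    (f : ι → ℕ → ℕ) : ∃ g : ℕ → ℕ, ∀ i, {n : ℕ | f i n = g n}.Infinite := by
  by_contra hg
  refine notMem_of_lt_csInf (Cardinal.mk_range_le.trans_lt hκ) (OrderBot.bddBelow _)
    ⟨Set.range f, rfl, ?_⟩
  simpa using hg

/-- In a star-ε-space every open cover has a sequence of members whose stars
absorb all finite sets. -/
theorem StarEpsilonSpace.exists_seq {X : Type*} [TopologicalSpace X]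
    (hε : StarEpsilonSpace X) {P : Set (Set X)} (hP : IsOpenCover P) :
    ∃ v : ℕ → Set X, (∀ m, v m ∈ P) ∧
      ∀ F : Set X, F.Finite → ∃ m, F ⊆ st (v m) P := by
  obtain ⟨V, hVP, hVc, hV⟩ := hε P hP
  obtain ⟨W, hW, -⟩ := hV ∅ Set.finite_empty
  obtain ⟨v, rfl⟩ := hVc.exists_eq_range ⟨W, hW⟩
  exact ⟨v, fun m => hVP ⟨m, rfl⟩, by simpa using hV⟩

/-- Under `S₁(Ω,Γ)`, one can select from sequences of open sets absorbing all finite sets,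
even if the whole space is among these sets. -/
theorem S1OmegaGamma.exists_eventually_mem {Z : Type*} [TopologicalSpace Z]
    (hZ : S1OmegaGamma Z) (S : ℕ → ℕ → Set Z) (hS : ∀ n m, IsOpen (S n m))
    (hfin : ∀ n (F : Set Z), F.Finite → ∃ m, F ⊆ S n m) :
    ∃ f : ℕ → ℕ, ∀ z, ∀ᶠ n in atTop, z ∈ S n (f n) := by
  classical
  have hω : ∀ n, (∀ m, S n m ≠ Set.univ) → IsOmegaCover (Set.range (S n)) := by
    intro n hn
    refine ⟨⟨by rintro _ ⟨m, rfl⟩; exact hS n m, ?_⟩, ?_, ?_⟩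
    · refine Set.eq_univ_of_forall fun z => ?_
      obtain ⟨m, hm⟩ := hfin n {z} (Set.finite_singleton z)
      exact ⟨S n m, ⟨m, rfl⟩, hm rfl⟩
    · rintro ⟨m, hm⟩
      exact hn m hm
    · intro F hF
      obtain ⟨m, hm⟩ := hfin n F hF
      exact ⟨S n m, ⟨m, rfl⟩, hm⟩
  by_cases htriv : ∀ n, ∃ m, S n m = Set.univ
  · choose f hf using htriv
    exact ⟨f, fun z => Eventually.of_forall fun n => by rw [hf]; trivial⟩
  push Not at htriv
  obtain ⟨k, hk⟩ := htriv
  obtain ⟨W, hW, hev⟩ := hZ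
    (fun n => Set.range (S (if ∀ m, S n m ≠ Set.univ then n else k)))
    (fun n => hω _ (by split_ifs with hn <;> assumption))
  have hf : ∀ n, ∃ m, W n ⊆ S n m := by
    intro n
    by_cases hn : ∀ m, S n m ≠ Set.univ
    · obtain ⟨m, hm⟩ := hW n
      rw [if_pos hn] at hm
      exact ⟨m, hm.ge⟩
    · push Not at hn
      obtain ⟨m, hm⟩ := hn
      exact ⟨m, hm ▸ Set.subset_univ _⟩
  choose f hf using hf
  exact ⟨f, fun z => (hev z).mono fun n hn => hf n hn⟩

/-- If a star-ε-space `X` is a union of fewer than `cov(M)` many subspaces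
each satisfying `S₁(Ω,Γ)`, then `X` is star-Rothberger. -/
theorem stmt16 {X : Type} [TopologicalSpace X] (hε : StarEpsilonSpace X)
    {ι : Type} (hκ : Cardinal.mk ι < covM) (Xa : ι → Set X)
    (hcov : (⋃ i, Xa i) = Set.univ)
    (h : ∀ i, S1OmegaGamma (Xa i)) :
    StarRothberger X := by
  intro U hU
  choose v hvU hvfin using fun n => hε.exists_seq (hU n)
  have hsel : ∀ i, ∃ f : ℕ → ℕ, ∀ z : Xa i, ∀ᶠ n in atTop, (z : X) ∈ st (v n (f n)) (U n) := by
    intro i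
    refine (h i).exists_eventually_mem (fun n m => Subtype.val ⁻¹' st (v n m) (U n))
      (fun n m => (isOpen_st (hU n).1 _).preimage continuous_subtype_val) fun n F hF => ?_
    obtain ⟨m, hm⟩ := hvfin n (Subtype.val '' F) (hF.image _)
    exact ⟨m, Set.image_subset_iff.1 hm⟩
  choose f hf using hsel
  obtain ⟨g, hg⟩ := exists_infinite_eq_of_mk_lt_covM hκ f
  refine ⟨fun n => v n (g n), fun n => hvU n _, Set.eq_univ_of_forall fun x => ?_⟩
  obtain ⟨i, hi⟩ := Set.mem_iUnion.1 (hcov ▸ Set.mem_univ x)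
  obtain ⟨n, hn, hxn⟩ :=
    ((Nat.frequently_atTop_iff_infinite.2 (hg i)).and_eventually (hf i ⟨x, hi⟩)).exists
  exact Set.mem_iUnion.2 ⟨n, by rwa [hn] at hxn⟩
end

section
/- Let X be a T₁ topological space that is star-Rothberger and has countable extent (every closed discrete subspace of X is countable). Then the Alexandroff duplicate A(X) of X is star-Rothberger. -/
open Set Filter

/-- The topology of the Alexandroff duplicate `A(X)` on `X × Bool`:
points `(x, true)` are isolated, and basic neighbourhoods of `(x, false)` are
the sets `(U × Bool) \ {(x, true)}` for open neighbourhoods `U` of `x`. -/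
def alexDup (X : Type*) [TopologicalSpace X] : TopologicalSpace (X × Bool) where
  IsOpen S := ∀ x : X, (x, false) ∈ S →
    ∃ U : Set X, IsOpen U ∧ x ∈ U ∧
      (U ×ˢ (Set.univ : Set Bool)) \ {(x, true)} ⊆ S
  isOpen_univ := fun x _ =>
    ⟨Set.univ, isOpen_univ, Set.mem_univ x, fun _ _ => Set.mem_univ _⟩
  isOpen_inter := by
    intro S T hS hT x hx
    obtain ⟨U, hU, hxU, hUS⟩ := hS x hx.1
    obtain ⟨V, hV, hxV, hVT⟩ := hT x hx.2
    refine ⟨U ∩ V, hU.inter hV, ⟨hxU, hxV⟩, fun p hp => ?_⟩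
    obtain ⟨⟨⟨hp1U, hp1V⟩, hp2⟩, hpne⟩ := hp
    exact ⟨hUS ⟨⟨hp1U, hp2⟩, hpne⟩, hVT ⟨⟨hp1V, hp2⟩, hpne⟩⟩
  isOpen_sUnion := by
    intro C hC x hx
    obtain ⟨S, hS, hxS⟩ := hx
    obtain ⟨U, hU, hxU, hUS⟩ := hC S hS x hxS
    exact ⟨U, hU, hxU, fun p hp => ⟨S, hS, hUS hp⟩⟩

theorem IsOpenCover.exists_mem {X : Type*} [TopologicalSpace X] {P : Set (Set X)}
    (hP : IsOpenCover P) (x : X) : ∃ U ∈ P, x ∈ U :=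
  mem_sUnion.1 (hP.2 ▸ mem_univ x)

theorem mem_st_of_mem {X : Type*} {P : Set (Set X)} {A : Set X} (hA : A ∈ P) {x : X}
    (hx : x ∈ A) : x ∈ st A P :=
  ⟨A, ⟨hA, x, hx, hx⟩, hx⟩

theorem StarRothberger.nonempty {X : Type*} [TopologicalSpace X] (h : StarRothberger X) :
    Nonempty X := by
  by_contra hX
  rw [not_nonempty_iff] at hX
  obtain ⟨V, hV, -⟩ := h (fun _ => ∅) fun _ => ⟨by simp, Subsingleton.elim _ _⟩
  exact hV 0

/-- A set each point of the space has a neighbourhood of meeting it at most in that point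
is closed and discrete. -/
theorem isClosed_and_discreteTopology_of_forall_inter_subset {X : Type*} [TopologicalSpace X]
    {D : Set X} (h : ∀ x, ∃ U, IsOpen U ∧ x ∈ U ∧ U ∩ D ⊆ {x}) :
    IsClosed D ∧ DiscreteTopology D := by
  constructor
  · rw [← isOpen_compl_iff, isOpen_iff_forall_mem_open]
    intro x hx
    obtain ⟨U, hU, hxU, hUD⟩ := h x
    refine ⟨U, fun y hy hyD => hx ?_, hU, hxU⟩
    rwa [← mem_singleton_iff.1 (hUD ⟨hy, hyD⟩)]
  · refine discreteTopology_iff_isOpen_singleton.2 fun x => ?_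
    obtain ⟨U, hU, hxU, hUD⟩ := h x
    refine ⟨U, hU, ?_⟩
    ext y
    exact ⟨fun hy => Subtype.ext (hUD ⟨hy, y.2⟩), fun hy => (mem_singleton_iff.1 hy) ▸ hxU⟩

/-- In the duplicate of a star-Rothberger space one can choose members of given open covers
whose stars cover the non-isolated copy of the space. -/
theorem StarRothberger.exists_alexDup_cover_false {X : Type*} [TopologicalSpace X]
    (hSR : StarRothberger X) (P : ℕ → Set (Set (X × Bool)))
    (hP : ∀ n, @IsOpenCover (X × Bool) (alexDup X) (P n)) :
    ∃ V : ℕ → Set (X × Bool), (∀ n, V n ∈ P n) ∧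
      ∀ x : X, (x, false) ∈ ⋃ n, st (V n) (P n) := by
  have h : ∀ n x, ∃ W ∈ P n, ∃ U : Set X, IsOpen U ∧ x ∈ U ∧
      (U ×ˢ (univ : Set Bool)) \ {(x, true)} ⊆ W := by
    intro n x
    let := alexDup X
    obtain ⟨W, hW, hxW⟩ := (hP n).exists_mem (x, false)
    exact ⟨W, hW, (hP n).1 W hW x hxW⟩
  choose W hW U hU hxU hUW using h
  have hfalse : ∀ n x y, y ∈ U n x → (y, false) ∈ W n x := fun n x y hy =>
    hUW n x ⟨⟨hy, mem_univ _⟩, by simp⟩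
  obtain ⟨V, hV, hcov⟩ := hSR (fun n => range (U n)) fun n =>
    ⟨by rintro _ ⟨x, rfl⟩; exact hU n x, eq_univ_of_forall fun x => ⟨_, ⟨x, rfl⟩, hxU n x⟩⟩
  choose c hc using hV
  refine ⟨fun n => W n (c n), fun n => hW n _, fun x => ?_⟩
  obtain ⟨n, hn⟩ := mem_iUnion.1 (hcov ▸ mem_univ x : x ∈ ⋃ n, st (V n) (range (U n)))
  obtain ⟨_, ⟨⟨z, rfl⟩, p, hpV, hpz⟩, hxz⟩ := hn
  rw [← hc n] at hpV
  exact mem_iUnion.2 ⟨n, W n z,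
    ⟨hW n z, (p, false), hfalse n _ p hpV, hfalse n z p hpz⟩, hfalse n z x hxz⟩

/-- Every T₁ star-Rothberger space with countable extent has star-Rothberger
Alexandroff duplicate. -/
theorem stmt18 {X : Type*} [TopologicalSpace X] [T1Space X]
    (hSR : StarRothberger X)
    (hext : ∀ D : Set X, IsClosed D → DiscreteTopology D → D.Countable) :
    @StarRothberger (X × Bool) (alexDup X) := by
  let := alexDup X
  intro P hP
  obtain ⟨V, hV, hVcov⟩ :=
    hSR.exists_alexDup_cover_false (fun n => P (2 * n)) fun n => hP (2 * n)
  set S : Set (X × Bool) := ⋃ n, st (V n) (P (2 * n))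
  have hSopen : IsOpen S :=
    isOpen_iUnion fun n => isOpen_sUnion fun B hB => (hP (2 * n)).1 B hB.1
  have hD := isClosed_and_discreteTopology_of_forall_inter_subset
    (D := {x : X | (x, true) ∉ S}) fun x => by
      obtain ⟨U, hU, hxU, hUS⟩ := hSopen x (hVcov x)
      refine ⟨U, hU, hxU, fun y hy => by_contra fun hyx => hy.2 (hUS ⟨⟨hy.1, mem_univ _⟩, ?_⟩)⟩
      simpa using hyx
  obtain ⟨x₀⟩ := hSR.nonempty
  obtain ⟨f, hf⟩ := ((hext _ hD.1 hD.2).insert x₀).exists_eq_range (insert_nonempty _ _)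
  choose W hW hfW using fun n => (hP (2 * n + 1)).exists_mem (f n, true)
  have hsel : ∀ n, ∃ A ∈ P n,
      (∀ k, n = 2 * k → A = V k) ∧ ∀ k, n = 2 * k + 1 → A = W k := by
    intro n
    obtain ⟨k, rfl | rfl⟩ := n.even_or_odd'
    · exact ⟨V k, hV k, fun j hj => by rw [show k = j by omega], fun j hj => by omega⟩
    · exact ⟨W k, hW k, fun j hj => by omega, fun j hj => by rw [show k = j by omega]⟩
  choose A hA hAeven hAodd using hsel
  refine ⟨A, hA, eq_univ_of_forall fun p => ?_⟩
  by_cases hp : p ∈ S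
  · obtain ⟨k, hk⟩ := mem_iUnion.1 hp
    exact mem_iUnion.2 ⟨2 * k, by rwa [hAeven _ k rfl]⟩
  · obtain ⟨x, _ | _⟩ := p
    · exact absurd (hVcov x) hp
    · obtain ⟨k, rfl⟩ : x ∈ range f := hf ▸ mem_insert_of_mem _ hp
      refine mem_iUnion.2 ⟨2 * k + 1, mem_st_of_mem (hA _) ?_⟩
      rw [hAodd _ k rfl]
      exact hfW k
end

section
/- Let X be a T₁ topological space whose Alexandroff duplicate A(X) is star-Lindelöf. Then X has countable extent, i.e., every closed discrete subspace of X is countable. -/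
open Set Filter

/-- `X` is star-Lindelöf. -/
def StarLindelof (X : Type*) [TopologicalSpace X] : Prop :=
  ∀ P : Set (Set X), IsOpenCover P →
    ∃ V ⊆ P, V.Countable ∧ st (⋃₀ V) P = Set.univ

/-- Every point has a neighbourhood meeting a closed discrete set in at most that point. -/
theorem IsClosed.exists_isOpen_inter_subset_singleton {X : Type*} [TopologicalSpace X]
    {D : Set X} (hD : IsClosed D) (hd : DiscreteTopology D) (x : X) :
    ∃ U : Set X, IsOpen U ∧ x ∈ U ∧ ∀ y ∈ U, y ∈ D → y = x := by
  by_cases hx : x ∈ D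
  · obtain ⟨U, hU, hUx⟩ := isOpen_induced_iff.1 (isOpen_discrete ({⟨x, hx⟩} : Set D))
    refine ⟨U, hU, ?_, fun y hy hyD => ?_⟩
    · have : (⟨x, hx⟩ : D) ∈ Subtype.val ⁻¹' U := hUx ▸ mem_singleton _
      exact this
    · have : (⟨y, hyD⟩ : D) ∈ ({⟨x, hx⟩} : Set D) := hUx ▸ hy
      exact congrArg Subtype.val this
  · exact ⟨Dᶜ, hD.isOpen_compl, hx, fun y hy hyD => absurd hyD hy⟩

/-- The isolated copy of a closed discrete set is closed in the Alexandroff duplicate. -/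
theorem isOpen_alexDup_compl_prod_true {X : Type*} [TopologicalSpace X]
    {D : Set X} (hD : IsClosed D) (hd : DiscreteTopology D) :
    @IsOpen (X × Bool) (alexDup X) (D ×ˢ {true})ᶜ := by
  intro x _
  obtain ⟨U, hU, hxU, h⟩ := hD.exists_isOpen_inter_subset_singleton hd x
  refine ⟨U, hU, hxU, ?_⟩
  rintro ⟨y, b⟩ ⟨⟨hy, -⟩, hne⟩ ⟨hyD, hb⟩
  exact hne (Prod.ext (h y hy hyD) hb)

/-- If the Alexandroff duplicate of a T₁ space `X` is star-Lindelöf, then `X`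
has countable extent: every closed discrete subspace of `X` is countable. -/
theorem stmt19 {X : Type*} [TopologicalSpace X] [T1Space X]
    (h : @StarLindelof (X × Bool) (alexDup X)) :
    ∀ D : Set X, IsClosed D → DiscreteTopology D → D.Countable := by
  intro D hD hd
  let P : Set (Set (X × Bool)) :=
    insert (D ×ˢ {true})ᶜ ((fun d : X => {(d, true)}) '' D)
  have hP : @IsOpenCover (X × Bool) (alexDup X) P := by
    constructor
    · rintro U (rfl | ⟨d, -, rfl⟩)
      · exact isOpen_alexDup_compl_prod_true hD hd
      · intro x hx
        simp at hx
    · refine eq_univ_of_forall fun p => ?_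
      by_cases hp : p ∈ D ×ˢ {true}
      · exact ⟨_, mem_insert_of_mem _ (mem_image_of_mem _ hp.1), Prod.ext rfl hp.2⟩
      · exact ⟨_, mem_insert _ _, hp⟩
  have eq_singleton : ∀ B ∈ P, ∀ d ∈ D, (d, true) ∈ B → B = {(d, true)} := by
    rintro B (rfl | ⟨e, -, rfl⟩) d hd hdB
    · exact absurd ⟨hd, rfl⟩ hdB
    · rw [mem_singleton_iff.1 hdB]
  obtain ⟨V, hVP, hV, hst⟩ := h P hP
  refine MapsTo.countable_of_injOn (f := fun d : X => ({(d, true)} : Set (X × Bool)))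
    (t := V) (fun d hdD => ?_) (fun a _ b _ hab => ?_) hV
  · have hmem : (d, true) ∈ st (⋃₀ V) P := hst ▸ mem_univ _
    obtain ⟨B, ⟨hB, p, ⟨W, hW, hpW⟩, hpB⟩, hdB⟩ := hmem
    rw [eq_singleton B hB d hdD hdB] at hpB
    rw [mem_singleton_iff.1 hpB] at hpW
    rwa [eq_singleton W (hVP hW) d hdD hpW] at hW
  · exact congrArg Prod.fst (singleton_injective hab)
end
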